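/- Let W : Ω × ℝ^d × ℝ^{d×N} → [0,∞) be continuous, satisfying (1/C)|ξ| - C ≤ W(x,u,ξ) ≤ C(1+|ξ|) and the recession estimate |W^∞(x,u,ξ) - W(x,u,tξ)/t| ≤ C|ξ|^{1-α}/t^α whenever t|ξ| > L, for some α ∈ (0,1) and C, L > 0. Then there exists C' > 0 such that |(QW)^∞(x,u,ξ) - QW(x,u,ξ)| ≤ C'(1+|ξ|^{1-α}) for all (x,u,ξ) ∈ Ω × ℝ^d × ℝ^{d×N}. -/

import Mathlib

open MeasureTheory Filter Set

noncomputable section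

/-- The open unit cube `Q = (0,1)^N` in `ℝ^N`. -/
def unitCube (N : ℕ) : Set (Fin N → ℝ) := Set.univ.pi fun _ => Set.Ioo (0:ℝ) 1

/-- The gradient matrix `∇φ(y) ∈ ℝ^{d×N}` of `φ : ℝ^N → ℝ^d`. -/
def gradMat {N d : ℕ} (φ : (Fin N → ℝ) → (Fin d → ℝ)) (y : Fin N → ℝ) :
    Fin d → Fin N → ℝ := fun i j => fderiv ℝ φ y (Pi.single j 1) i

/-- Test functions in `W_0^{1,∞}(Q;ℝ^d)`: Lipschitz maps vanishing outside the unit cube. -/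
def TestFun {N d : ℕ} (φ : (Fin N → ℝ) → (Fin d → ℝ)) : Prop :=
  (∃ K, LipschitzWith K φ) ∧ ∀ y ∉ unitCube N, φ y = 0

/-- Quasiconvex envelope (quasiconvexification) of `h` computed over the unit cube. -/
def qcEnv {N d : ℕ} (h : (Fin d → Fin N → ℝ) → ℝ) (ξ : Fin d → Fin N → ℝ) : ℝ :=
  sInf {r | ∃ φ, TestFun φ ∧ r = ∫ y in unitCube N, h (ξ + gradMat φ y)}

/-- Recession function: `h^∞(ξ) = limsup_{t→∞} h(tξ)/t`. -/
def recFn {N d : ℕ} (h : (Fin d → Fin N → ℝ) → ℝ) (ξ : Fin d → Fin N → ℝ) : ℝ :=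
  Filter.limsup (fun t : ℝ => h (t • ξ) / t) Filter.atTop

/-- Quasiconvexity in the sense of Morrey: for some bounded open set `D` of positive
measure, `h(ξ) ≤ (1/|D|) ∫_D h(ξ + ∇φ)` for all Lipschitz `φ` vanishing outside `D`. -/
def MorreyQC {N d : ℕ} (h : (Fin d → Fin N → ℝ) → ℝ) : Prop :=
  ∃ D : Set (Fin N → ℝ), IsOpen D ∧ Bornology.IsBounded D ∧ 0 < volume D ∧
    ∀ (ξ : Fin d → Fin N → ℝ) (φ : (Fin N → ℝ) → Fin d → ℝ),
      (∃ K, LipschitzWith K φ) → (∀ y ∉ D, φ y = 0) →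
      h ξ ≤ ((volume D).toReal)⁻¹ * ∫ y in D, h (ξ + gradMat φ y)

/-- A modulus of continuity. -/
def Modulus (ω : ℝ → ℝ) : Prop := Continuous ω ∧ ω 0 = 0 ∧ ∀ t, 0 ≤ ω t

/-- Convex envelope of `g : ℝ^m → ℝ`: pointwise supremum of convex minorants. -/
def convEnv {m : ℕ} (g : (Fin m → ℝ) → ℝ) (v : Fin m → ℝ) : ℝ :=
  sSup {r | ∃ h : (Fin m → ℝ) → ℝ, ConvexOn ℝ Set.univ h ∧ (∀ w, h w ≤ g w) ∧ r = h v}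

/-- Supremum of lower semicontinuous convex minorants (the biconjugate `g**`). -/
def biconj {m : ℕ} (g : (Fin m → ℝ) → ℝ) (v : Fin m → ℝ) : ℝ :=
  sSup {r | ∃ h : (Fin m → ℝ) → ℝ, ConvexOn ℝ Set.univ h ∧ LowerSemicontinuous h ∧
    (∀ w, h w ≤ g w) ∧ r = h v}

/-- Quasiconvex-convex envelope of `f(ξ,v)` over the unit cube. -/
def qcxcEnv {N d m : ℕ} (f : (Fin d → Fin N → ℝ) → (Fin m → ℝ) → ℝ)
    (ξ : Fin d → Fin N → ℝ) (v : Fin m → ℝ) : ℝ :=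
  sInf {r | ∃ (ψ : (Fin N → ℝ) → Fin d → ℝ) (η : (Fin N → ℝ) → Fin m → ℝ),
    TestFun ψ ∧ Measurable η ∧ (∃ M, ∀ y, ‖η y‖ ≤ M) ∧
    (∫ y in unitCube N, η y) = 0 ∧
    r = ∫ y in unitCube N, f (ξ + gradMat ψ y) (v + η y)}



lemma aux_gradMat_smul {N d : ℕ} (φ : (Fin N → ℝ) → (Fin d → ℝ)) (c : ℝ) (y : Fin N → ℝ) :
    gradMat (c • φ) y = c • gradMat φ y := by
  funext i j
  simp [gradMat, fderiv_const_smul_field]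

lemma aux_testFun_smul {N d : ℕ} {φ : (Fin N → ℝ) → (Fin d → ℝ)} (h : TestFun φ) (c : ℝ) :
    TestFun (c • φ) := by
  obtain ⟨⟨K, hK⟩, h0⟩ := h
  refine ⟨⟨‖c‖₊ * K, (lipschitzWith_smul c).comp hK⟩, fun y hy => ?_⟩
  simp [h0 y hy]

lemma aux_vol (N : ℕ) : volume (unitCube N) = 1 := by
  simp [unitCube, Real.volume_pi_Ioo, volume_pi_pi]

lemma aux_integrable {N d : ℕ} {h : (Fin d → Fin N → ℝ) → ℝ} (hc : Continuous h)
    {φ : (Fin N → ℝ) → (Fin d → ℝ)} (hφ : TestFun φ) (ξ : Fin d → Fin N → ℝ) :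
    IntegrableOn (fun y => h (ξ + gradMat φ y)) (unitCube N) := by
  obtain ⟨⟨K, hK⟩, -⟩ := hφ
  have hm : Measurable (gradMat φ) := by
    refine measurable_pi_lambda _ fun i => measurable_pi_lambda _ fun j => ?_
    exact (measurable_pi_apply i).comp (measurable_fderiv_apply_const ℝ φ (Pi.single j 1))
  have hb : ∀ y, ‖gradMat φ y‖ ≤ K := by
    intro y
    refine (pi_norm_le_iff_of_nonneg K.2).2 fun i => (pi_norm_le_iff_of_nonneg K.2).2 fun j => ?_
    calc ‖fderiv ℝ φ y (Pi.single j 1) i‖ ≤ ‖fderiv ℝ φ y (Pi.single j 1)‖ := norm_le_pi_norm _ i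
      _ ≤ ‖fderiv ℝ φ y‖ * ‖(Pi.single j 1 : Fin N → ℝ)‖ := ContinuousLinearMap.le_opNorm _ _
      _ ≤ K * 1 := by
        gcongr
        · exact norm_fderiv_le_of_lipschitz ℝ hK
        · simp [Pi.norm_single]
      _ = K := mul_one _
  obtain ⟨M, hM⟩ := (isCompact_closedBall ξ (K : ℝ)).exists_bound_of_continuousOn hc.continuousOn
  refine Measure.integrableOn_of_bounded (M := M) (by simp [aux_vol]) ?_ ?_
  · exact (hc.measurable.comp (hm.const_add ξ)).aestronglyMeasurable
  · refine Eventually.of_forall fun y => hM _ ?_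
    simpa using hb y

lemma aux_bdd {N d : ℕ} {h : (Fin d → Fin N → ℝ) → ℝ} (h0 : ∀ η, 0 ≤ h η)
    (ξ : Fin d → Fin N → ℝ) :
    ∀ r ∈ {r | ∃ φ, TestFun φ ∧ r = ∫ y in unitCube N, h (ξ + gradMat φ y)}, 0 ≤ r := by
  rintro r ⟨φ, -, rfl⟩
  exact integral_nonneg fun y => h0 _

lemma aux_zero {N d : ℕ} : TestFun (0 : (Fin N → ℝ) → (Fin d → ℝ)) :=
  ⟨⟨0, LipschitzWith.const 0⟩, fun _ _ => rfl⟩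

lemma aux_le {N d : ℕ} {h : (Fin d → Fin N → ℝ) → ℝ} (h0 : ∀ η, 0 ≤ h η)
    (ξ : Fin d → Fin N → ℝ) : qcEnv h ξ ≤ h ξ := by
  refine csInf_le ⟨0, fun r hr => aux_bdd h0 ξ r hr⟩ ⟨0, aux_zero, ?_⟩
  have : ∀ y, gradMat (0 : (Fin N → ℝ) → (Fin d → ℝ)) y = 0 := by
    intro y; funext i j; simp [gradMat]
  simp [this, aux_vol, Measure.real]

lemma aux_mono {N d : ℕ} {h₁ h₂ : (Fin d → Fin N → ℝ) → ℝ} (hc₁ : Continuous h₁)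
    (hc₂ : Continuous h₂) (h0 : ∀ η, 0 ≤ h₁ η) (a b : ℝ) (ha : 0 < a)
    (hle : ∀ η, h₁ η ≤ a * h₂ η + b) (ξ : Fin d → Fin N → ℝ) :
    qcEnv h₁ ξ ≤ a * qcEnv h₂ ξ + b := by
  have key : (qcEnv h₁ ξ - b) / a ≤ qcEnv h₂ ξ := by
    refine le_csInf ⟨_, 0, aux_zero, rfl⟩ ?_
    rintro r ⟨φ, hφ, rfl⟩
    rw [div_le_iff₀ ha, sub_le_iff_le_add]
    have h1 : qcEnv h₁ ξ ≤ ∫ y in unitCube N, h₁ (ξ + gradMat φ y) :=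
      csInf_le ⟨0, fun r hr => aux_bdd h0 ξ r hr⟩ ⟨φ, hφ, rfl⟩
    have hi₂ := (aux_integrable hc₂ hφ ξ).const_mul a
    have hib : IntegrableOn (fun _ : Fin N → ℝ => b) (unitCube N) :=
      integrableOn_const (by simp [aux_vol])
    have h2 : ∫ y in unitCube N, h₁ (ξ + gradMat φ y) ≤
        ∫ y in unitCube N, (a * h₂ (ξ + gradMat φ y) + b) :=
      integral_mono (aux_integrable hc₁ hφ ξ) (hi₂.add hib) fun y => hle _
    rw [integral_add hi₂ hib, integral_const_mul] at h2
    simp [aux_vol, Measure.real] at h2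
    linarith
  rw [div_le_iff₀ ha] at key
  linarith

lemma aux_scale {N d : ℕ} (h : (Fin d → Fin N → ℝ) → ℝ) (t : ℝ) (ht : 0 < t)
    (h0 : ∀ η, 0 ≤ h η) (ξ : Fin d → Fin N → ℝ) :
    qcEnv h (t • ξ) / t = qcEnv (fun η => h (t • η) / t) ξ := by
  apply le_antisymm
  · refine le_csInf ⟨_, 0, aux_zero, rfl⟩ ?_
    rintro r ⟨φ, hφ, rfl⟩
    rw [integral_div]
    gcongr
    refine csInf_le ⟨0, fun r hr => aux_bdd h0 _ r hr⟩ ⟨t • φ, aux_testFun_smul hφ t, ?_⟩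
    simp only [aux_gradMat_smul, smul_add]
  · rw [le_div_iff₀ ht]
    refine le_csInf ⟨_, 0, aux_zero, rfl⟩ ?_
    rintro r ⟨φ, hφ, rfl⟩
    rw [← le_div_iff₀ ht, ← integral_div]
    refine csInf_le ⟨0, fun r hr => aux_bdd (fun η => div_nonneg (h0 _) ht.le) _ r hr⟩
      ⟨t⁻¹ • φ, aux_testFun_smul hφ _, ?_⟩
    simp only [aux_gradMat_smul, smul_add, smul_inv_smul₀ ht.ne']

lemma aux_young {α : ℝ} (hα : α ∈ Set.Ioo (0:ℝ) 1) {a s : ℝ} (ha : 0 ≤ a) (hs : 0 < s) :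
    a ^ (1 - α) ≤ s ^ (1 - α) + s ^ (-α) * a := by
  have h1 : 0 ≤ s ^ (-α) * a := by positivity
  have h2 : 0 ≤ s ^ (1 - α) := by positivity
  rcases le_or_gt a s with h | h
  · have := Real.rpow_le_rpow ha h (by linarith [hα.2] : 0 ≤ 1 - α)
    linarith
  · have h3 : a ^ (-α) ≤ s ^ (-α) :=
      Real.rpow_le_rpow_of_nonpos hs h.le (by linarith [hα.1])
    have h4 : a ^ (1 - α) = a ^ (-α) * a := by
      rw [show 1 - α = -α + 1 by ring, Real.rpow_add_one (by linarith)]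
    rw [h4]
    nlinarith

lemma aux_main {N d : ℕ} (h : (Fin d → Fin N → ℝ) → ℝ) (hc : Continuous h)
    (h0 : ∀ η, 0 ≤ h η) (C : ℝ) (hC : 0 < C)
    (hW : ∀ ξ, (1 / C) * ‖ξ‖ - C ≤ h ξ ∧ h ξ ≤ C * (1 + ‖ξ‖))
    (α L : ℝ) (hα : α ∈ Set.Ioo (0:ℝ) 1) (hL : 0 < L)
    (hrec : ∀ ξ, ∀ t : ℝ, t * ‖ξ‖ > L →
      |recFn h ξ - h (t • ξ) / t| ≤ C * ‖ξ‖ ^ ((1:ℝ) - α) / t ^ α)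
    (ξ : Fin d → Fin N → ℝ) (t : ℝ) (ht : 1 ≤ t) :
    |qcEnv h (t • ξ) / t - qcEnv h ξ| ≤
      (C * (1 + L) + 2 * C + 4 * C ^ 3) * (1 + ‖ξ‖ ^ ((1:ℝ) - α)) := by
  have ht0 : 0 < t := by linarith
  set ht' : (Fin d → Fin N → ℝ) → ℝ := fun η => h (t • η) / t with hdef
  have hct : Continuous ht' := by fun_prop
  have h0t : ∀ η, 0 ≤ ht' η := fun η => div_nonneg (h0 _) ht0.le
  have hup : ∀ η, ht' η ≤ C * (1 + ‖η‖) := by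
    intro η
    rw [hdef]
    simp only
    rw [div_le_iff₀ ht0]
    have := (hW (t • η)).2
    rw [norm_smul, Real.norm_of_nonneg ht0.le] at this
    nlinarith [norm_nonneg η]
  have hlow : ∀ η, ‖η‖ ≤ C * h η + C ^ 2 := by
    intro η
    have := (hW η).1
    have h2 : C * (1 / C * ‖η‖ - C) ≤ C * h η := by gcongr
    have h3 : C * (1 / C * ‖η‖ - C) = ‖η‖ - C ^ 2 := by field_simp
    linarith
  have hlowt : ∀ η, ‖η‖ ≤ C * ht' η + C ^ 2 := by
    intro η
    have := hlow (t • η)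
    rw [norm_smul, Real.norm_of_nonneg ht0.le] at this
    have h3 : h (t • η) = t * ht' η := by rw [hdef]; field_simp
    rw [h3] at this
    have h4 : t * ‖η‖ ≤ t * (C * ht' η + C ^ 2) := by nlinarith [sq_nonneg C]
    exact le_of_mul_le_mul_left h4 ht0
  have hdiff : ∀ η, |ht' η - h η| ≤ C * (1 + L) + 2 * C * ‖η‖ ^ (1 - α) := by
    intro η
    have hp : 0 ≤ ‖η‖ ^ (1 - α) := by positivity
    rcases le_or_gt ‖η‖ L with hη | hη
    · have e1 := hup η
      have e2 := (hW η).2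
      have e3 := h0 η
      have e4 := h0t η
      have e5 : C * (1 + ‖η‖) ≤ C * (1 + L) := by gcongr
      have e6 : 0 ≤ C * ‖η‖ ^ (1 - α) := by positivity
      rw [abs_le]
      constructor <;> linarith
    · have e1 := hrec η 1 (by linarith)
      have e2 := hrec η t (by nlinarith [norm_nonneg η])
      have e3 : C * ‖η‖ ^ (1 - α) / t ^ α ≤ C * ‖η‖ ^ (1 - α) :=
        div_le_self (by positivity) (Real.one_le_rpow ht hα.1.le)
      simp only [one_smul, div_one, Real.one_rpow] at e1
      have e4 : 0 ≤ C * (1 + L) := by positivity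
      rw [abs_le] at e1 e2 ⊢
      simp only [hdef]
      constructor <;> linarith [e1.1, e1.2, e2.1, e2.2]
  set s := 1 + ‖ξ‖ with hs
  have hs1 : 1 ≤ s := by linarith [norm_nonneg ξ]
  have hs0 : 0 < s := by linarith
  set p := s ^ (1 - α) with hp
  set q := s ^ (-α) with hq
  have hq0 : 0 < q := by positivity
  have hq1 : q ≤ 1 := Real.rpow_le_one_of_one_le_of_nonpos hs1 (by linarith [hα.1])
  have hqs : q * s = p := by
    rw [hp, hq, show 1 - α = -α + 1 by ring, Real.rpow_add_one (by linarith)]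
  have hp1 : p ≤ 1 + ‖ξ‖ ^ (1 - α) := by
    have := Real.rpow_add_le_add_rpow (zero_le_one) (norm_nonneg ξ)
      (by linarith [hα.2] : 0 ≤ 1 - α) (by linarith [hα.1])
    simpa using this
  have hz : 0 ≤ ‖ξ‖ ^ (1 - α) := by positivity
  have gen : ∀ h₁ h₂ : (Fin d → Fin N → ℝ) → ℝ, Continuous h₁ → Continuous h₂ →
      (∀ η, 0 ≤ h₁ η) → (∀ η, 0 ≤ h₂ η) → (∀ η, ‖η‖ ≤ C * h₂ η + C ^ 2) →
      (∀ η, h₂ η ≤ C * (1 + ‖η‖)) →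
      (∀ η, h₁ η - h₂ η ≤ C * (1 + L) + 2 * C * ‖η‖ ^ (1 - α)) →
      qcEnv h₁ ξ - qcEnv h₂ ξ ≤
        (C * (1 + L) + 2 * C + 4 * C ^ 3) * (1 + ‖ξ‖ ^ ((1:ℝ) - α)) := by
    intro h₁ h₂ c₁ c₂ n₁ n₂ l₂ u₂ dd
    have m := aux_mono c₁ c₂ n₁ (1 + 2 * C ^ 2 * q)
      (C * (1 + L) + 2 * C * p + 2 * C ^ 3 * q) (by positivity) (fun η => by
        have y := aux_young hα (norm_nonneg η) hs0
        have y2 : 2 * C * ‖η‖ ^ (1 - α) ≤ 2 * C * (p + q * (C * h₂ η + C ^ 2)) := by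
          gcongr
          refine y.trans ?_
          gcongr
          exact l₂ η
        linarith [dd η]) ξ
    have k : qcEnv h₂ ξ ≤ C * s := (aux_le n₂ ξ).trans (u₂ ξ)
    have k2 : 2 * C ^ 2 * q * qcEnv h₂ ξ ≤ 2 * C ^ 2 * q * (C * s) := by gcongr
    have k3 : 2 * C ^ 2 * q * (C * s) = 2 * C ^ 3 * p := by rw [← hqs]; ring
    have k4 : 2 * C ^ 3 * p ≤ 2 * C ^ 3 * (1 + ‖ξ‖ ^ (1 - α)) := by gcongr
    have k5 : 2 * C * p ≤ 2 * C * (1 + ‖ξ‖ ^ (1 - α)) := by gcongr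
    have k6 : 2 * C ^ 3 * q ≤ 2 * C ^ 3 * (1 + ‖ξ‖ ^ (1 - α)) := by gcongr; linarith
    have k7 : C * (1 + L) * 1 ≤ C * (1 + L) * (1 + ‖ξ‖ ^ (1 - α)) := by gcongr; linarith
    linarith
  rw [aux_scale h t ht0 h0 ξ, abs_le]
  have g1 := gen ht' h hct hc h0t h0 hlow (fun η => (hW η).2) fun η => (abs_le.1 (hdiff η)).2
  have g2 := gen h ht' hc hct h0 h0t hlowt hup fun η => by linarith [(abs_le.1 (hdiff η)).1]
  constructor <;> linarith

theorem stmt9 {N d : ℕ} (Ω : Set (Fin N → ℝ)) (hΩo : IsOpen Ω) (hΩb : Bornology.IsBounded Ω)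
    (W : (Fin N → ℝ) → (Fin d → ℝ) → (Fin d → Fin N → ℝ) → ℝ)
    (hWcont : Continuous fun p : (Fin N → ℝ) × (Fin d → ℝ) × (Fin d → Fin N → ℝ) =>
      W p.1 p.2.1 p.2.2)
    (hWnonneg : ∀ x ∈ Ω, ∀ (u : Fin d → ℝ) (ξ : Fin d → Fin N → ℝ), 0 ≤ W x u ξ)
    (C : ℝ) (hC : 0 < C)
    (hW : ∀ x ∈ Ω, ∀ (u : Fin d → ℝ) (ξ : Fin d → Fin N → ℝ),
      (1 / C) * ‖ξ‖ - C ≤ W x u ξ ∧ W x u ξ ≤ C * (1 + ‖ξ‖))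
    (α L : ℝ) (hα : α ∈ Set.Ioo (0:ℝ) 1) (hL : 0 < L)
    (hrec : ∀ x ∈ Ω, ∀ (u : Fin d → ℝ) (ξ : Fin d → Fin N → ℝ), ∀ t : ℝ, t * ‖ξ‖ > L →
      |recFn (W x u) ξ - W x u (t • ξ) / t| ≤ C * ‖ξ‖ ^ ((1:ℝ) - α) / t ^ α) :
    ∃ C' > (0:ℝ), ∀ x ∈ Ω, ∀ (u : Fin d → ℝ) (ξ : Fin d → Fin N → ℝ),
      |recFn (qcEnv (W x u)) ξ - qcEnv (W x u) ξ| ≤ C' * (1 + ‖ξ‖ ^ ((1:ℝ) - α)) := by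
  refine ⟨C * (1 + L) + 2 * C + 4 * C ^ 3, by positivity, fun x hx u ξ => ?_⟩
  have hc : Continuous (W x u) :=
    hWcont.comp (by fun_prop : Continuous fun ξ : Fin d → Fin N → ℝ => (x, u, ξ))
  have key := aux_main (W x u) hc (hWnonneg x hx u) C hC (hW x hx u) α L hα hL (hrec x hx u) ξ
  set B := (C * (1 + L) + 2 * C + 4 * C ^ 3) * (1 + ‖ξ‖ ^ ((1:ℝ) - α))
  have hu : ∀ᶠ t : ℝ in atTop, qcEnv (W x u) (t • ξ) / t ≤ qcEnv (W x u) ξ + B := by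
    filter_upwards [eventually_ge_atTop 1] with t ht
    linarith [(abs_le.1 (key t ht)).2]
  have hl : ∀ᶠ t : ℝ in atTop, qcEnv (W x u) ξ - B ≤ qcEnv (W x u) (t • ξ) / t := by
    filter_upwards [eventually_ge_atTop 1] with t ht
    linarith [(abs_le.1 (key t ht)).1]
  have h1 : recFn (qcEnv (W x u)) ξ ≤ qcEnv (W x u) ξ + B :=
    limsup_le_of_le (IsCoboundedUnder.of_frequently_ge hl.frequently) hu
  have h2 : qcEnv (W x u) ξ - B ≤ recFn (qcEnv (W x u)) ξ :=
    le_limsup_of_frequently_le hl.frequently ⟨_, hu⟩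
  rw [abs_le]
  constructor <;> linarith


end
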